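/- Let F be a 2-CNF formula over a variable type V, let T be a truth assignment, and let A be a set of literals. If there exists a literal l such that both l and its negation ¬l belong to R_{A,T}, then F is not satisfiable under the assumptions A; that is, no truth assignment simultaneously satisfies F and makes every literal of A agree with it. -/

import Mathlib

/-- Negation of a literal `(v, b)` is `(v, ¬b)`. -/
def negLit {V : Type*} (l : V × Bool) : V × Bool := (l.1, !l.2)

/-- A literal `(v, b)` agrees with the truth assignment `T` if `T v = b`. -/
def agrees {V : Type*} (T : V → Bool) (l : V × Bool) : Prop := T l.1 = l.2

/-- `T` satisfies a clause if at least one of its two literals agrees with `T`. -/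
def satClause {V : Type*} (T : V → Bool) (c : (V × Bool) × (V × Bool)) : Prop :=
  agrees T c.1 ∨ agrees T c.2

/-- `T` satisfies a 2-CNF formula `F` (a set of clauses) if it satisfies every clause. -/
def satisfies {V : Type*} (T : V → Bool) (F : Set ((V × Bool) × (V × Bool))) : Prop :=
  ∀ c ∈ F, satClause T c

/-- Edge relation of the implication graph `G_F`: for each clause `(l₁, l₂)` of `F`,
there are edges from `¬l₁` to `l₂` and from `¬l₂` to `l₁`. -/
def edge {V : Type*} (F : Set ((V × Bool) × (V × Bool))) (l l' : V × Bool) : Prop :=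
  ∃ c ∈ F, (l = negLit c.1 ∧ l' = c.2) ∨ (l = negLit c.2 ∧ l' = c.1)

/-- `R_{A,T}`: the set of literals reachable in `G_F` from some literal of `A` by a path
in which every traversed edge leaves a literal that disagrees with `T`. -/
def RAT {V : Type*} (F : Set ((V × Bool) × (V × Bool))) (A : Set (V × Bool))
    (T : V → Bool) : Set (V × Bool) :=
  { l | ∃ a ∈ A, Relation.ReflTransGen (fun x y => edge F x y ∧ ¬ agrees T x) a l }

/-- `F` is satisfiable under the assumptions `A`: some truth assignment satisfies `F`
and makes every literal of `A` agree with it. -/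
def satUnder {V : Type*} (F : Set ((V × Bool) × (V × Bool))) (A : Set (V × Bool)) : Prop :=
  ∃ T : V → Bool, satisfies T F ∧ ∀ l ∈ A, agrees T l

theorem agrees_negLit_iff {V : Type*} (T : V → Bool) (l : V × Bool) :
    agrees T (negLit l) ↔ ¬ agrees T l := by
  cases hT : T l.1 <;> cases hl : l.2 <;> simp [agrees, negLit, hT, hl]

/-- A satisfying assignment propagates along the edges of the implication graph. -/
theorem agrees_of_edge {V : Type*} {F : Set ((V × Bool) × (V × Bool))} {S : V → Bool}
    (hS : satisfies S F) {x y : V × Bool} (hxy : edge F x y) (hx : agrees S x) :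
    agrees S y := by
  obtain ⟨c, hc, ⟨rfl, rfl⟩ | ⟨rfl, rfl⟩⟩ := hxy
  · exact (hS c hc).resolve_left ((agrees_negLit_iff S c.1).1 hx)
  · exact (hS c hc).resolve_right ((agrees_negLit_iff S c.2).1 hx)

/-- An assignment satisfying `F` and the assumptions `A` agrees with every literal of
`R_{A,T}`. -/
theorem agrees_of_mem_RAT {V : Type*} {F : Set ((V × Bool) × (V × Bool))}
    {A : Set (V × Bool)} {S T : V → Bool} (hS : satisfies S F)
    (hA : ∀ a ∈ A, agrees S a) {l : V × Bool} (hl : l ∈ RAT F A T) : agrees S l := by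
  obtain ⟨a, ha, hal⟩ := hl
  induction hal with
  | refl => exact hA a ha
  | tail _ hxy ih => exact agrees_of_edge hS hxy.1 ih

theorem stmt1 {V : Type*} (F : Set ((V × Bool) × (V × Bool))) (T : V → Bool)
    (A : Set (V × Bool))
    (h : ∃ l : V × Bool, l ∈ RAT F A T ∧ negLit l ∈ RAT F A T) :
    ¬ satUnder F A := by
  obtain ⟨l, hl, hnl⟩ := h
  rintro ⟨S, hS, hA⟩
  exact (agrees_negLit_iff S l).1 (agrees_of_mem_RAT hS hA hnl) (agrees_of_mem_RAT hS hA hl)
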